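/- arXiv:2303.09716 — 2 statements merged into one kernel-verified Lean document; each statement's English description precedes it below -/
import Mathlib

section
/- (Theorem 1, convergence) Let m ≥ 1 and H ≥ 1 be integers satisfying α^{H−1} + 2(1+α^m)·α^{H−1}/(1−α) < 1. Let V_0 ∈ ℝ^S and define iterates V_{k+1} = T_{μ_{k+1},ν_{k+1}}^m(T^{H−1}V_k), where for each k the pair (μ_{k+1},ν_{k+1}) is an H-step lookahead policy for V_k. Then V_k → J* as k → ∞. -/
open Finset Filter Topology Matrix

noncomputable section

/-- The probability simplex over a finite subset `D` of actions: nonnegative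
weights summing to one over `D` and vanishing outside `D`. -/
def simplex {A : Type*} [Fintype A] (D : Finset A) : Set (A → ℝ) :=
  {p | (∀ a, 0 ≤ p a) ∧ (∑ a ∈ D, p a = 1) ∧ ∀ a ∉ D, p a = 0}

/-- A finite two-player zero-sum discounted Markov game. `S` is the state space,
`A` the maximizer's global action type, `B` the minimizer's global action type. -/
structure MarkovGame (S A B : Type*) [Fintype S] [Fintype A] [Fintype B] where
  U : S → Finset A
  W : S → Finset B
  U_nonempty : ∀ s, (U s).Nonempty
  W_nonempty : ∀ s, (W s).Nonempty
  P : S → A → B → S → ℝ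
  P_nonneg : ∀ s u v s', 0 ≤ P s u v s'
  P_sum : ∀ s, ∀ u ∈ U s, ∀ v ∈ W s, ∑ s', P s u v s' = 1
  g : S → A → B → ℝ
  g_nonneg : ∀ s u v, 0 ≤ g s u v
  g_le_one : ∀ s u v, g s u v ≤ 1
  α : ℝ
  α_pos : 0 < α
  α_lt_one : α < 1

namespace MarkovGame

variable {S A B : Type*} [Fintype S] [Fintype A] [Fintype B]

/-- The state-action value matrix `A_{V,s}(u,v) = g(s,u,v) + α Σ_{s'} P(s'|s,u,v) V(s')`. -/
def Aval (G : MarkovGame S A B) (V : S → ℝ) (s : S) (u : A) (v : B) : ℝ :=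
  G.g s u v + G.α * ∑ s', G.P s u v s' * V s'

/-- A policy pair assigns to each state probability vectors over the available actions. -/
def IsPolicy (G : MarkovGame S A B) (μ : S → A → ℝ) (ν : S → B → ℝ) : Prop :=
  ∀ s, μ s ∈ simplex (G.U s) ∧ ν s ∈ simplex (G.W s)

/-- The Bellman operator of a policy pair: `(T_{μ,ν}V)(s) = μ(s)ᵀ A_{V,s} ν(s)`. -/
def Tpol (G : MarkovGame S A B) (μ : S → A → ℝ) (ν : S → B → ℝ) (V : S → ℝ) : S → ℝ :=
  fun s => ∑ u ∈ G.U s, ∑ v ∈ G.W s, μ s u * ν s v * G.Aval V s u v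

/-- The Bellman optimality operator:
`(TV)(s) = max_{p ∈ Δ(U(s))} min_{q ∈ Δ(V(s))} pᵀ A_{V,s} q`. -/
def T (G : MarkovGame S A B) (V : S → ℝ) : S → ℝ :=
  fun s => sSup {x | ∃ p ∈ simplex (G.U s),
    x = sInf {y | ∃ q ∈ simplex (G.W s),
      y = ∑ u ∈ G.U s, ∑ v ∈ G.W s, p u * q v * G.Aval V s u v}}

/-- The transition matrix `P_{μ,ν}` of a policy pair. -/
def Ppol (G : MarkovGame S A B) (μ : S → A → ℝ) (ν : S → B → ℝ) : Matrix S S ℝ :=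
  Matrix.of fun s s' => ∑ u ∈ G.U s, ∑ v ∈ G.W s, μ s u * ν s v * G.P s u v s'

/-- The expected one-step reward `g_{μ,ν}` of a policy pair. -/
def gpol (G : MarkovGame S A B) (μ : S → A → ℝ) (ν : S → B → ℝ) : S → ℝ :=
  fun s => ∑ u ∈ G.U s, ∑ v ∈ G.W s, μ s u * ν s v * G.g s u v

/-- `(μ,ν)` is an `H`-step lookahead policy for `V` if it is a policy pair and
`T_{μ,ν}(T^{H-1}V) = T^H V`. -/
def IsLookahead (G : MarkovGame S A B) (H : ℕ) (μ : S → A → ℝ) (ν : S → B → ℝ)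
    (V : S → ℝ) : Prop :=
  G.IsPolicy μ ν ∧ G.Tpol μ ν (G.T^[H - 1] V) = G.T^[H] V

end MarkovGame

theorem simplex_nonempty {A : Type*} [Fintype A] {D : Finset A} (hD : D.Nonempty) :
    (simplex D).Nonempty := by
  classical
  obtain ⟨a, ha⟩ := hD
  refine ⟨fun x => if x = a then 1 else 0, fun x => ?_, ?_, fun x hx => ?_⟩
  · dsimp only
    split_ifs <;> norm_num
  · simp [ha]
  · have : x ≠ a := fun h => hx (h ▸ ha)
    simp [this]

/-- A bilinear average of a matrix is at most any upper bound of its entries. -/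
theorem sum_simplex_mul_le {A B : Type*} [Fintype A] [Fintype B] {D : Finset A} {E : Finset B}
    {p : A → ℝ} {q : B → ℝ} (hp : p ∈ simplex D) (hq : q ∈ simplex E)
    (M : A → B → ℝ) (c : ℝ) (hM : ∀ u ∈ D, ∀ v ∈ E, M u v ≤ c) :
    ∑ u ∈ D, ∑ v ∈ E, p u * q v * M u v ≤ c := by
  calc ∑ u ∈ D, ∑ v ∈ E, p u * q v * M u v
      ≤ ∑ u ∈ D, ∑ v ∈ E, p u * q v * c :=
        sum_le_sum fun u hu => sum_le_sum fun v hv =>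
          mul_le_mul_of_nonneg_left (hM u hu v hv) (mul_nonneg (hp.1 u) (hq.1 v))
    _ = (∑ u ∈ D, p u) * (∑ v ∈ E, q v) * c := by
        rw [sum_mul_sum, sum_mul]
        exact sum_congr rfl fun u _ => (sum_mul _ _ _).symm
    _ = c := by rw [hp.2.1, hq.2.1]; ring

theorem sSup_sInf_le_add {X Y : Type*} {P : Set X} {Q : Set Y} (hP : P.Nonempty)
    (hQ : Q.Nonempty) (f f' : X → Y → ℝ) (K c : ℝ)
    (hf : ∀ p ∈ P, ∀ q ∈ Q, -K ≤ f p q) (hf' : ∀ p ∈ P, ∀ q ∈ Q, -K ≤ f' p q ∧ f' p q ≤ K)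
    (h : ∀ p ∈ P, ∀ q ∈ Q, f p q ≤ f' p q + c) :
    sSup {x | ∃ p ∈ P, x = sInf {y | ∃ q ∈ Q, y = f p q}} ≤
      sSup {x | ∃ p ∈ P, x = sInf {y | ∃ q ∈ Q, y = f' p q}} + c := by
  obtain ⟨p₀, hp₀⟩ := hP
  obtain ⟨q₀, hq₀⟩ := hQ
  have hbdd : BddAbove {x | ∃ p ∈ P, x = sInf {y | ∃ q ∈ Q, y = f' p q}} := by
    refine ⟨K, ?_⟩
    rintro x ⟨p, hp, rfl⟩
    refine le_trans (csInf_le ⟨-K, ?_⟩ ⟨q₀, hq₀, rfl⟩) (hf' p hp q₀ hq₀).2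
    rintro y ⟨q, hq, rfl⟩
    exact (hf' p hp q hq).1
  refine csSup_le ⟨_, p₀, hp₀, rfl⟩ ?_
  rintro x ⟨p, hp, rfl⟩
  refine le_trans ?_ (add_le_add_left (le_csSup hbdd ⟨p, hp, rfl⟩) c)
  rw [← sub_le_iff_le_add]
  refine le_csInf ⟨_, q₀, hq₀, rfl⟩ ?_
  rintro y ⟨q, hq, rfl⟩
  rw [sub_le_iff_le_add]
  refine le_trans (csInf_le ⟨-K, ?_⟩ ⟨q, hq, rfl⟩) (h p hp q hq)
  rintro y ⟨q', hq', rfl⟩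
  exact hf p hp q' hq'

namespace MarkovGame

variable {S A B : Type*} [Fintype S] [Fintype A] [Fintype B]

theorem Aval_sub_le (G : MarkovGame S A B) (V V' : S → ℝ) (s : S) {u : A} {v : B}
    (hu : u ∈ G.U s) (hv : v ∈ G.W s) :
    G.Aval V s u v - G.Aval V' s u v ≤ G.α * dist V V' := by
  have h : ∑ s', G.P s u v s' * V s' - ∑ s', G.P s u v s' * V' s' ≤ dist V V' := by
    rw [← sum_sub_distrib]
    calc ∑ s', (G.P s u v s' * V s' - G.P s u v s' * V' s')
        ≤ ∑ s', G.P s u v s' * dist V V' := by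
          refine sum_le_sum fun s' _ => ?_
          rw [← mul_sub]
          refine mul_le_mul_of_nonneg_left ?_ (G.P_nonneg _ _ _ _)
          exact (le_abs_self _).trans (dist_le_pi_dist V V' s')
      _ = dist V V' := by rw [← sum_mul, G.P_sum s u hu v hv, one_mul]
  have := mul_le_mul_of_nonneg_left h G.α_pos.le
  unfold Aval
  linarith

theorem value_le_add (G : MarkovGame S A B) (V V' : S → ℝ) (s : S) {p : A → ℝ} {q : B → ℝ}
    (hp : p ∈ simplex (G.U s)) (hq : q ∈ simplex (G.W s)) :
    ∑ u ∈ G.U s, ∑ v ∈ G.W s, p u * q v * G.Aval V s u v ≤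
      ∑ u ∈ G.U s, ∑ v ∈ G.W s, p u * q v * G.Aval V' s u v + G.α * dist V V' := by
  have := sum_simplex_mul_le hp hq (fun u v => G.Aval V s u v - G.Aval V' s u v) _
    fun u hu v hv => G.Aval_sub_le V V' s hu hv
  simp only [mul_sub, sum_sub_distrib] at this
  linarith

theorem dist_Tpol_le (G : MarkovGame S A B) {μ : S → A → ℝ} {ν : S → B → ℝ}
    (h : G.IsPolicy μ ν) (V V' : S → ℝ) :
    dist (G.Tpol μ ν V) (G.Tpol μ ν V') ≤ G.α * dist V V' := by
  refine (dist_pi_le_iff (mul_nonneg G.α_pos.le dist_nonneg)).2 fun s => ?_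
  have h₁ := G.value_le_add V V' s (h s).1 (h s).2
  have h₂ := G.value_le_add V' V s (h s).1 (h s).2
  rw [dist_comm V' V] at h₂
  rw [Real.dist_eq, abs_sub_le_iff]
  unfold Tpol
  constructor <;> linarith

theorem exists_abs_Aval_le (G : MarkovGame S A B) (V : S → ℝ) (s : S) :
    ∃ K, ∀ u v, |G.Aval V s u v| ≤ K := by
  refine ⟨∑ u, ∑ v, |G.Aval V s u v|, fun u v => ?_⟩
  refine le_trans ?_ (single_le_sum (f := fun u => ∑ v, |G.Aval V s u v|)
    (fun u _ => sum_nonneg fun v _ => abs_nonneg _) (mem_univ u))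
  exact single_le_sum (f := fun v => |G.Aval V s u v|) (fun v _ => abs_nonneg _) (mem_univ v)

theorem exists_value_bounds (G : MarkovGame S A B) (V : S → ℝ) (s : S) :
    ∃ K, ∀ p ∈ simplex (G.U s), ∀ q ∈ simplex (G.W s),
      -K ≤ ∑ u ∈ G.U s, ∑ v ∈ G.W s, p u * q v * G.Aval V s u v ∧
        ∑ u ∈ G.U s, ∑ v ∈ G.W s, p u * q v * G.Aval V s u v ≤ K := by
  obtain ⟨K, hK⟩ := G.exists_abs_Aval_le V s
  refine ⟨K, fun p hp q hq => ⟨?_, ?_⟩⟩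
  · have := sum_simplex_mul_le hp hq (fun u v => -G.Aval V s u v) K
      fun u _ v _ => (neg_le_abs _).trans (hK u v)
    simp only [mul_neg, sum_neg_distrib] at this
    linarith
  · exact sum_simplex_mul_le hp hq _ K fun u _ v _ => (le_abs_self _).trans (hK u v)

theorem T_le_add (G : MarkovGame S A B) (V V' : S → ℝ) (s : S) :
    G.T V s ≤ G.T V' s + G.α * dist V V' := by
  obtain ⟨K, hK⟩ := G.exists_value_bounds V s
  obtain ⟨K', hK'⟩ := G.exists_value_bounds V' s
  refine sSup_sInf_le_add (simplex_nonempty (G.U_nonempty s)) (simplex_nonempty (G.W_nonempty s))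
    (fun p q => ∑ u ∈ G.U s, ∑ v ∈ G.W s, p u * q v * G.Aval V s u v)
    (fun p q => ∑ u ∈ G.U s, ∑ v ∈ G.W s, p u * q v * G.Aval V' s u v) (max K K') _
    (fun p hp q hq => ?_) (fun p hp q hq => ⟨?_, ?_⟩)
    (fun p hp q hq => G.value_le_add V V' s hp hq)
  · exact (neg_le_neg (le_max_left K K')).trans (hK p hp q hq).1
  · exact (neg_le_neg (le_max_right K K')).trans (hK' p hp q hq).1
  · exact (hK' p hp q hq).2.trans (le_max_right K K')

theorem dist_T_le (G : MarkovGame S A B) (V V' : S → ℝ) :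
    dist (G.T V) (G.T V') ≤ G.α * dist V V' := by
  refine (dist_pi_le_iff (mul_nonneg G.α_pos.le dist_nonneg)).2 fun s => ?_
  have h₁ := G.T_le_add V V' s
  have h₂ := G.T_le_add V' V s
  rw [dist_comm V' V] at h₂
  rw [Real.dist_eq, abs_sub_le_iff]
  constructor <;> linarith

theorem dist_iterate_T_le (G : MarkovGame S A B) {J : S → ℝ} (hJ : G.T J = J) (V : S → ℝ)
    (n : ℕ) : dist (G.T^[n] V) J ≤ G.α ^ n * dist V J := by
  induction n with
  | zero => simp
  | succ n ih =>
    rw [Function.iterate_succ_apply']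
    calc dist (G.T (G.T^[n] V)) J = dist (G.T (G.T^[n] V)) (G.T J) := by rw [hJ]
      _ ≤ G.α * dist (G.T^[n] V) J := G.dist_T_le _ _
      _ ≤ G.α * (G.α ^ n * dist V J) := mul_le_mul_of_nonneg_left ih G.α_pos.le
      _ = G.α ^ (n + 1) * dist V J := by ring

theorem dist_iterate_Tpol_self_le (G : MarkovGame S A B) {μ : S → A → ℝ} {ν : S → B → ℝ}
    (h : G.IsPolicy μ ν) (V : S → ℝ) (n : ℕ) :
    dist ((G.Tpol μ ν)^[n] V) V ≤ dist (G.Tpol μ ν V) V / (1 - G.α) := by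
  have hα : 0 < 1 - G.α := sub_pos.2 G.α_lt_one
  induction n with
  | zero => simpa using div_nonneg dist_nonneg hα.le
  | succ n ih =>
    rw [Function.iterate_succ_apply']
    calc dist (G.Tpol μ ν ((G.Tpol μ ν)^[n] V)) V
        ≤ dist (G.Tpol μ ν ((G.Tpol μ ν)^[n] V)) (G.Tpol μ ν V) + dist (G.Tpol μ ν V) V :=
          dist_triangle _ _ _
      _ ≤ G.α * (dist (G.Tpol μ ν V) V / (1 - G.α)) + dist (G.Tpol μ ν V) V :=
          add_le_add_left
            ((G.dist_Tpol_le h _ _).trans (mul_le_mul_of_nonneg_left ih G.α_pos.le)) _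
      _ = dist (G.Tpol μ ν V) V / (1 - G.α) := by
          field_simp
          ring

theorem dist_lookahead_step_le (G : MarkovGame S A B) {H : ℕ} (hH : 1 ≤ H)
    {μ : S → A → ℝ} {ν : S → B → ℝ} {V J : S → ℝ} (h : G.IsLookahead H μ ν V)
    (hJ : G.T J = J) (m : ℕ) :
    dist ((G.Tpol μ ν)^[m] (G.T^[H - 1] V)) J ≤
      (1 + 2 / (1 - G.α)) * G.α ^ (H - 1) * dist V J := by
  obtain ⟨n, rfl⟩ : ∃ n, H = n + 1 := ⟨H - 1, by omega⟩
  have hα : 0 < 1 - G.α := sub_pos.2 G.α_lt_one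
  have hstep := h.2
  simp only [Nat.add_sub_cancel, Function.iterate_succ_apply'] at hstep ⊢
  set X := G.T^[n] V
  have hX : dist X J ≤ G.α ^ n * dist V J := G.dist_iterate_T_le hJ V n
  have hres : dist (G.Tpol μ ν X) X ≤ 2 * dist X J := by
    have h₁ : dist (G.T X) J ≤ G.α * dist X J := by
      simpa only [hJ] using G.dist_T_le X J
    have h₂ : G.α * dist X J ≤ 1 * dist X J :=
      mul_le_mul_of_nonneg_right G.α_lt_one.le dist_nonneg
    have h₃ := dist_triangle_right (G.T X) X J
    rw [hstep]
    linarith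
  calc dist ((G.Tpol μ ν)^[m] X) J ≤ dist ((G.Tpol μ ν)^[m] X) X + dist X J :=
        dist_triangle _ _ _
    _ ≤ 2 * dist X J / (1 - G.α) + dist X J :=
        add_le_add_left ((G.dist_iterate_Tpol_self_le h.1 X m).trans
          (div_le_div_of_nonneg_right hres hα.le)) _
    _ = (1 + 2 / (1 - G.α)) * dist X J := by ring
    _ ≤ (1 + 2 / (1 - G.α)) * (G.α ^ n * dist V J) :=
        mul_le_mul_of_nonneg_left hX (by positivity)
    _ = (1 + 2 / (1 - G.α)) * G.α ^ n * dist V J := by ring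

end MarkovGame

/-- Theorem 1, convergence: If
`α^{H−1} + 2(1+α^m)α^{H−1}/(1−α) < 1`, then the iterates
`V_{k+1} = T_{μ_{k+1},ν_{k+1}}^m(T^{H−1}V_k)` (with `H`-step lookahead policies)
converge to `J*`. -/
theorem stmt_12 {S A B : Type*} [Fintype S] [Fintype A] [Fintype B]
    (G : MarkovGame S A B) (m H : ℕ) (hm : 1 ≤ m) (hH : 1 ≤ H)
    (hass : G.α ^ (H - 1) + 2 * (1 + G.α ^ m) * G.α ^ (H - 1) / (1 - G.α) < 1)
    (Vseq : ℕ → S → ℝ) (μ : ℕ → S → A → ℝ) (ν : ℕ → S → B → ℝ)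
    (hLA : ∀ k, G.IsLookahead H (μ k) (ν k) (Vseq k))
    (hiter : ∀ k, Vseq (k + 1) = (G.Tpol (μ k) (ν k))^[m] (G.T^[H - 1] (Vseq k)))
    (Jstar : S → ℝ) (hJ : G.T Jstar = Jstar) :
    Tendsto Vseq atTop (𝓝 Jstar) := by
  have hα : 0 < 1 - G.α := sub_pos.2 G.α_lt_one
  have hα₀ := G.α_pos
  set c := (1 + 2 / (1 - G.α)) * G.α ^ (H - 1) with hc
  have hc₀ : 0 ≤ c := by positivity
  have hc₁ : c < 1 := by
    refine lt_of_le_of_lt ?_ hass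
    have h₁ : 0 ≤ 2 * G.α ^ m * G.α ^ (H - 1) / (1 - G.α) := by positivity
    calc c ≤ c + 2 * G.α ^ m * G.α ^ (H - 1) / (1 - G.α) := le_add_of_nonneg_right h₁
      _ = G.α ^ (H - 1) + 2 * (1 + G.α ^ m) * G.α ^ (H - 1) / (1 - G.α) := by
        rw [hc]
        ring
  have hbound : ∀ k, dist (Vseq k) Jstar ≤ c ^ k * dist (Vseq 0) Jstar := by
    intro k
    induction k with
    | zero => simp
    | succ k ih =>
      rw [hiter k]
      calc _ ≤ c * dist (Vseq k) Jstar := G.dist_lookahead_step_le hH (hLA k) hJ m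
        _ ≤ c * (c ^ k * dist (Vseq 0) Jstar) := mul_le_mul_of_nonneg_left ih hc₀
        _ = c ^ (k + 1) * dist (Vseq 0) Jstar := by ring
  rw [tendsto_iff_dist_tendsto_zero]
  refine squeeze_zero (fun _ => dist_nonneg) hbound ?_
  simpa using (tendsto_pow_atTop_nhds_zero_of_lt_one hc₀ hc₁).mul_const (dist (Vseq 0) Jstar)
end
end

section
/- Let m ≥ 1 and H ≥ 1 be integers, V ∈ ℝ^S, and let (μ,ν) be an H-step lookahead policy for V. Let M : ℝ^S → ℝ^S be a linear map with ‖M‖_∞ ≤ δ_FV and ‖M J^{μ,ν} − J^{μ,ν}‖_∞ ≤ δ. Then ‖M(T_{μ,ν}^m(T^{H−1}V)) − J*‖_∞ ≤ (α^{H−1} + (1+α)·(1 + α^m·δ_FV)·α^{H−1}/(1−α))·‖V − J*‖_∞ + δ. -/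
open Finset Filter Topology Matrix

noncomputable section

namespace MarkovGame

/-- The expected value `pᵀ A_{V,s} q` of the one-state matrix game at `s`. -/
def payoff {S A B : Type*} [Fintype S] [Fintype A] [Fintype B] (G : MarkovGame S A B)
    (V : S → ℝ) (s : S) (p : A → ℝ) (q : B → ℝ) : ℝ :=
  ∑ u ∈ G.U s, ∑ v ∈ G.W s, p u * q v * G.Aval V s u v

end MarkovGame

theorem sum_simplex_mul_simplex {A B : Type*} [Fintype A] [Fintype B] {D : Finset A}
    {E : Finset B} {p : A → ℝ} {q : B → ℝ} (hp : p ∈ simplex D) (hq : q ∈ simplex E) (c : ℝ) :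
    ∑ u ∈ D, ∑ v ∈ E, p u * q v * c = c := by
  have h : ∀ u ∈ D, ∑ v ∈ E, p u * q v * c = p u * c := fun u _ => by
    rw [← Finset.sum_mul, ← Finset.mul_sum, hq.2.1, mul_one]
  rw [Finset.sum_congr rfl h, ← Finset.sum_mul, hp.2.1, one_mul]

namespace MarkovGame

section Contraction

variable {S A B : Type*} [Fintype S] [Fintype A] [Fintype B] (G : MarkovGame S A B)

theorem Aval_le_Aval_add (V V' : S → ℝ) {s : S} {u : A} {v : B} (hu : u ∈ G.U s)
    (hv : v ∈ G.W s) : G.Aval V s u v ≤ G.Aval V' s u v + G.α * dist V V' := by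
  have hsum : ∑ s', G.P s u v s' * V s' ≤ ∑ s', G.P s u v s' * V' s' + dist V V' := by
    calc ∑ s', G.P s u v s' * V s'
        ≤ ∑ s', G.P s u v s' * (V' s' + dist V V') := by
          refine Finset.sum_le_sum fun s' _ => mul_le_mul_of_nonneg_left ?_ (G.P_nonneg s u v s')
          have h := (le_abs_self _).trans (dist_le_pi_dist V V' s')
          linarith
      _ = ∑ s', G.P s u v s' * V' s' + dist V V' := by
          simp only [mul_add, Finset.sum_add_distrib, ← Finset.sum_mul, G.P_sum s u hu v hv,
            one_mul]
  have h := mul_le_mul_of_nonneg_left hsum G.α_pos.le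
  unfold Aval
  linarith

theorem payoff_le_payoff_add (V V' : S → ℝ) {s : S} {p : A → ℝ} {q : B → ℝ}
    (hp : p ∈ simplex (G.U s)) (hq : q ∈ simplex (G.W s)) :
    G.payoff V s p q ≤ G.payoff V' s p q + G.α * dist V V' := by
  rw [← sum_simplex_mul_simplex hp hq (G.α * dist V V')]
  simp only [payoff, ← Finset.sum_add_distrib, ← mul_add]
  exact Finset.sum_le_sum fun u hu => Finset.sum_le_sum fun v hv =>
    mul_le_mul_of_nonneg_left (G.Aval_le_Aval_add V V' hu hv) (mul_nonneg (hp.1 u) (hq.1 v))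

theorem payoff_zero_mem_Icc {s : S} {p : A → ℝ} {q : B → ℝ}
    (hp : p ∈ simplex (G.U s)) (hq : q ∈ simplex (G.W s)) :
    G.payoff 0 s p q ∈ Set.Icc (0 : ℝ) 1 := by
  have hpq : ∀ u v, 0 ≤ p u * q v := fun u v => mul_nonneg (hp.1 u) (hq.1 v)
  have hA : ∀ u v, G.Aval 0 s u v = G.g s u v := fun u v => by simp [Aval]
  simp only [payoff, hA]
  refine ⟨Finset.sum_nonneg fun u _ => Finset.sum_nonneg fun v _ =>
    mul_nonneg (hpq u v) (G.g_nonneg s u v), ?_⟩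
  rw [← sum_simplex_mul_simplex hp hq 1]
  exact Finset.sum_le_sum fun u _ => Finset.sum_le_sum fun v _ =>
    mul_le_mul_of_nonneg_left (G.g_le_one s u v) (hpq u v)

theorem neg_le_payoff (V : S → ℝ) {s : S} {p : A → ℝ} {q : B → ℝ}
    (hp : p ∈ simplex (G.U s)) (hq : q ∈ simplex (G.W s)) :
    -(G.α * dist 0 V) ≤ G.payoff V s p q := by
  linarith [G.payoff_le_payoff_add 0 V hp hq, (G.payoff_zero_mem_Icc hp hq).1]

theorem payoff_le (V : S → ℝ) {s : S} {p : A → ℝ} {q : B → ℝ}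
    (hp : p ∈ simplex (G.U s)) (hq : q ∈ simplex (G.W s)) :
    G.payoff V s p q ≤ 1 + G.α * dist V 0 := by
  linarith [G.payoff_le_payoff_add V 0 hp hq, (G.payoff_zero_mem_Icc hp hq).2]

theorem T_apply (V : S → ℝ) (s : S) :
    G.T V s = sSup ((fun p => sInf (G.payoff V s p '' simplex (G.W s))) '' simplex (G.U s)) := by
  simp only [T, Set.image, payoff, eq_comm]

theorem bddBelow_payoff (V : S → ℝ) {s : S} {p : A → ℝ} (hp : p ∈ simplex (G.U s)) :
    BddBelow (G.payoff V s p '' simplex (G.W s)) :=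
  ⟨_, Set.forall_mem_image.2 fun _ hq => G.neg_le_payoff V hp hq⟩

theorem bddAbove_sInf_payoff (V : S → ℝ) (s : S) :
    BddAbove ((fun p => sInf (G.payoff V s p '' simplex (G.W s))) '' simplex (G.U s)) := by
  obtain ⟨q, hq⟩ := simplex_nonempty (G.W_nonempty s)
  exact ⟨_, Set.forall_mem_image.2 fun p hp =>
    (csInf_le (G.bddBelow_payoff V hp) (Set.mem_image_of_mem _ hq)).trans (G.payoff_le V hp hq)⟩

theorem T_le_T_add (V V' : S → ℝ) (s : S) : G.T V s ≤ G.T V' s + G.α * dist V V' := by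
  rw [T_apply, T_apply]
  refine csSup_le ((simplex_nonempty (G.U_nonempty s)).image _)
    (Set.forall_mem_image.2 fun p hp => ?_)
  have hinf : sInf (G.payoff V s p '' simplex (G.W s)) - G.α * dist V V' ≤
      sInf (G.payoff V' s p '' simplex (G.W s)) := by
    refine le_csInf ((simplex_nonempty (G.W_nonempty s)).image _)
      (Set.forall_mem_image.2 fun q hq => ?_)
    linarith [csInf_le (G.bddBelow_payoff V hp) (Set.mem_image_of_mem _ hq),
      G.payoff_le_payoff_add V V' hp hq]
  linarith [le_csSup (G.bddAbove_sInf_payoff V' s) (Set.mem_image_of_mem _ hp)]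

theorem contractingWith_of_le_add {F : (S → ℝ) → S → ℝ}
    (hF : ∀ V V' s, F V s ≤ F V' s + G.α * dist V V') :
    ContractingWith ⟨G.α, G.α_pos.le⟩ F := by
  refine ⟨G.α_lt_one, LipschitzWith.of_dist_le_mul fun V V' => ?_⟩
  refine (dist_pi_le_iff (mul_nonneg G.α_pos.le dist_nonneg)).2 fun s => ?_
  have h₁ := hF V V' s
  have h₂ := hF V' V s
  rw [dist_comm V' V] at h₂
  rw [Real.dist_eq, abs_le]
  constructor <;> linarith

theorem contractingWith_T : ContractingWith ⟨G.α, G.α_pos.le⟩ G.T :=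
  G.contractingWith_of_le_add G.T_le_T_add

theorem contractingWith_Tpol {μ : S → A → ℝ} {ν : S → B → ℝ} (h : G.IsPolicy μ ν) :
    ContractingWith ⟨G.α, G.α_pos.le⟩ (G.Tpol μ ν) :=
  G.contractingWith_of_le_add fun V V' s => G.payoff_le_payoff_add V V' (h s).1 (h s).2

end Contraction

end MarkovGame

theorem LipschitzWith.dist_iterate_le_of_isFixedPt {X : Type*} [PseudoMetricSpace X]
    {K : NNReal} {f : X → X} (hf : LipschitzWith K f) {y : X} (hy : Function.IsFixedPt f y)
    (x : X) (n : ℕ) : dist (f^[n] x) y ≤ K ^ n * dist x y := by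
  have h := (hf.iterate n).dist_le_mul x y
  rwa [hy.iterate n, NNReal.coe_pow] at h

/-- If `(μ,ν)` is an `H`-step lookahead policy for `V`, `M` is a
linear map with `‖M‖_∞ ≤ δ_FV` and `‖M J^{μ,ν} − J^{μ,ν}‖_∞ ≤ δ`, then
`‖M(T_{μ,ν}^m(T^{H−1}V)) − J*‖_∞ ≤
  (α^{H−1} + (1+α)(1 + α^m δ_FV) α^{H−1}/(1−α))‖V − J*‖_∞ + δ`. -/
theorem stmt_16 {S A B : Type*} [Fintype S] [Fintype A] [Fintype B]
    (G : MarkovGame S A B) (m H : ℕ) (hm : 1 ≤ m) (hH : 1 ≤ H) (V : S → ℝ)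
    (μ : S → A → ℝ) (ν : S → B → ℝ) (hLA : G.IsLookahead H μ ν V)
    (Jmn : S → ℝ) (hfix : G.Tpol μ ν Jmn = Jmn)
    (Jstar : S → ℝ) (hJ : G.T Jstar = Jstar)
    (M : (S → ℝ) →L[ℝ] (S → ℝ)) (δFV δ : ℝ)
    (hM : ‖M‖ ≤ δFV) (happ : ‖M Jmn - Jmn‖ ≤ δ) :
    ‖M ((G.Tpol μ ν)^[m] (G.T^[H - 1] V)) - Jstar‖ ≤
      (G.α ^ (H - 1) + (1 + G.α) * (1 + G.α ^ m * δFV) * G.α ^ (H - 1) / (1 - G.α)) *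
        ‖V - Jstar‖ + δ := by
  obtain ⟨hpol, hlook⟩ := hLA
  have hT := G.contractingWith_T
  have hTp := G.contractingWith_Tpol hpol
  set Y := G.T^[H - 1] V
  have hα : 0 < 1 - G.α := sub_pos.2 G.α_lt_one
  have hY : dist Y Jstar ≤ G.α ^ (H - 1) * dist V Jstar :=
    hT.2.dist_iterate_le_of_isFixedPt hJ V (H - 1)
  have hstep : G.Tpol μ ν Y = G.T Y := by
    rw [hlook, ← Function.iterate_succ_apply' G.T, Nat.succ_eq_add_one, Nat.sub_add_cancel hH]
  have hres : dist Y (G.Tpol μ ν Y) ≤ (1 + G.α) * (G.α ^ (H - 1) * dist V Jstar) := by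
    have h : dist (G.T Y) Jstar ≤ G.α * dist Y Jstar := by
      have h := hT.2.dist_le_mul Y Jstar
      rwa [hJ] at h
    rw [hstep]
    nlinarith [dist_triangle_right Y (G.T Y) Jstar, G.α_pos]
  have hD : dist Y Jmn ≤ (1 + G.α) * (G.α ^ (H - 1) * dist V Jstar) / (1 - G.α) :=
    (hTp.dist_le_of_fixedPoint Y hfix).trans (div_le_div_of_nonneg_right hres hα.le)
  have hiter : dist ((G.Tpol μ ν)^[m] Y) Jmn ≤ G.α ^ m * dist Y Jmn :=
    hTp.2.dist_iterate_le_of_isFixedPt hfix Y m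
  have hδFV : 0 ≤ δFV := (norm_nonneg M).trans hM
  have hMiter : dist (M ((G.Tpol μ ν)^[m] Y)) (M Jmn) ≤ δFV * (G.α ^ m * dist Y Jmn) := by
    rw [dist_eq_norm, ← map_sub]
    refine (M.le_of_opNorm_le hM _).trans ?_
    rw [← dist_eq_norm]
    gcongr
  rw [← dist_eq_norm] at happ ⊢
  rw [← dist_eq_norm]
  calc dist (M ((G.Tpol μ ν)^[m] Y)) Jstar
      ≤ dist (M ((G.Tpol μ ν)^[m] Y)) (M Jmn) + dist (M Jmn) Jmn + dist Jmn Y + dist Y Jstar :=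
        (dist_triangle _ Y _).trans (by gcongr; exact dist_triangle4 _ _ _ _)
    _ ≤ δFV * (G.α ^ m * dist Y Jmn) + δ + dist Y Jmn + G.α ^ (H - 1) * dist V Jstar := by
        rw [dist_comm Jmn Y]
        gcongr
    _ = (1 + G.α ^ m * δFV) * dist Y Jmn + (G.α ^ (H - 1) * dist V Jstar + δ) := by ring
    _ ≤ (1 + G.α ^ m * δFV) * ((1 + G.α) * (G.α ^ (H - 1) * dist V Jstar) / (1 - G.α)) +
          (G.α ^ (H - 1) * dist V Jstar + δ) := by
        have := G.α_pos
        gcongr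
    _ = _ := by ring
end
end
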